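/- Let n ≥ 4 be an integer and ℓ_1, …, ℓ_n ∈ ℝ. For any four distinct indices i, j, k, m ∈ {1,…,n}, the operators L_{i,j} on real-valued functions on ℤ^n satisfy the identity: ℓ_k(2+ℓ_k)ℓ_m(2+ℓ_m)·L_{i,j} = {[L_{j,k},L_{k,m}],[L_{i,k},L_{k,m}]} − {L_{k,m},[L_{i,k},[L_{j,k},L_{k,m}]]} − 2{L_{k,m}, L_{i,k}L_{j,m}} + ℓ_kℓ_m·[L_{i,k},[L_{k,m},L_{j,m}]] + ℓ_jℓ_m·{L_{i,k},L_{k,m}} − ℓ_m(ℓ_m+2)·{L_{i,k},L_{j,k}} − ℓ_k(ℓ_k+2)·{L_{i,m},L_{j,m}} + ℓ_iℓ_k·{L_{j,m},L_{k,m}} − 4·L_{j,k}L_{i,m} + 2(−2+ℓ_kℓ_m)·L_{i,k}L_{j,m} + 2ℓ_j(1+ℓ_k)ℓ_m·L_{i,k} + ℓ_jℓ_k(2+2ℓ_m+ℓ_kℓ_m)·L_{i,m} + ℓ_iℓ_m(2+2ℓ_k+ℓ_kℓ_m)·L_{j,k} + 2ℓ_iℓ_k(1+ℓ_m)·L_{j,m}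 − ℓ_iℓ_jℓ_kℓ_m·L_{k,m}, where [A,B] = AB − BA and {A,B} = AB + BA. -/

import Mathlib

open Finset

/-- The operator `L_{i,j}` for distinct `i, j ∈ {1,…,n}`. -/
def Lop (n : ℕ) (ℓ : Fin n → ℝ) (i j : Fin n) (f : (Fin n → ℤ) → ℝ) :
    (Fin n → ℤ) → ℝ := fun x =>
  (x j : ℝ) * ((x i : ℝ) - ℓ i) * (f (x + Pi.single i 1 - Pi.single j 1) - f x) +
    (x i : ℝ) * ((x j : ℝ) - ℓ j) * (f (x + Pi.single j 1 - Pi.single i 1) - f x)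

/-- Commutator `[A,B] = AB - BA` of operators. -/
def opComm {F : Type*} [AddCommGroup F] (A B : F → F) : F → F := A ∘ B - B ∘ A

/-- Anticommutator `{A,B} = AB + BA` of operators. -/
def opAComm {F : Type*} [AddCommGroup F] (A B : F → F) : F → F := A ∘ B + B ∘ A


set_option linter.unusedSimpArgs false
set_option linter.unusedVariables false
set_option linter.unusedTactic false

namespace S11

abbrev G := ℤ → ℤ → ℤ → ℤ → ℝ

def Mij (la lb : ℝ) (g : G) : G := fun a b c d =>
  (b : ℝ) * ((a : ℝ) - la) * (g (a + 1) (b - 1) c d - g a b c d) +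
    (a : ℝ) * ((b : ℝ) - lb) * (g (a - 1) (b + 1) c d - g a b c d)

def Mik (la lc : ℝ) (g : G) : G := fun a b c d =>
  (c : ℝ) * ((a : ℝ) - la) * (g (a + 1) b (c - 1) d - g a b c d) +
    (a : ℝ) * ((c : ℝ) - lc) * (g (a - 1) b (c + 1) d - g a b c d)

def Mim (la ld : ℝ) (g : G) : G := fun a b c d =>
  (d : ℝ) * ((a : ℝ) - la) * (g (a + 1) b c (d - 1) - g a b c d) +
    (a : ℝ) * ((d : ℝ) - ld) * (g (a - 1) b c (d + 1) - g a b c d)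

def Mjk (lb lc : ℝ) (g : G) : G := fun a b c d =>
  (c : ℝ) * ((b : ℝ) - lb) * (g a (b + 1) (c - 1) d - g a b c d) +
    (b : ℝ) * ((c : ℝ) - lc) * (g a (b - 1) (c + 1) d - g a b c d)

def Mjm (lb ld : ℝ) (g : G) : G := fun a b c d =>
  (d : ℝ) * ((b : ℝ) - lb) * (g a (b + 1) c (d - 1) - g a b c d) +
    (b : ℝ) * ((d : ℝ) - ld) * (g a (b - 1) c (d + 1) - g a b c d)

def Mkm (lc ld : ℝ) (g : G) : G := fun a b c d =>
  (d : ℝ) * ((c : ℝ) - lc) * (g a b (c + 1) (d - 1) - g a b c d) +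
    (c : ℝ) * ((d : ℝ) - ld) * (g a b (c - 1) (d + 1) - g a b c d)

lemma commA (la lb lc ld : ℝ) (g : G) : opComm (Mjk lb lc) (Mkm lc ld) g = fun a b c d =>
      0 - (b - lb) * d * (2 * c - lc) * g a (b + 1) c (d - 1)
      + (d - ld) * b * (2 * c - lc) * g a (b - 1) c (d + 1)
      + (b - lb) * c * (2 * d - ld) * g a (b + 1) (c - 1) d
      - (c - lc) * b * (2 * d - ld) * g a (b - 1) (c + 1) d
      + (c - lc) * d * (2 * b - lb) * g a b (c + 1) (d - 1)
      - (d - ld) * c * (2 * b - lb) * g a b (c - 1) (d + 1) := by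
  funext a b c d
  simp only [opComm, Pi.sub_apply, Function.comp_apply, Mjk, Mkm, add_sub_cancel_right, sub_add_cancel]
  push_cast
  ring

lemma commB (la lb lc ld : ℝ) (g : G) : opComm (Mik la lc) (Mkm lc ld) g = fun a b c d =>
      0 - (a - la) * d * (2 * c - lc) * g (a + 1) b c (d - 1)
      + (d - ld) * a * (2 * c - lc) * g (a - 1) b c (d + 1)
      + (a - la) * c * (2 * d - ld) * g (a + 1) b (c - 1) d
      - (c - lc) * a * (2 * d - ld) * g (a - 1) b (c + 1) d
      + (c - lc) * d * (2 * a - la) * g a b (c + 1) (d - 1)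
      - (d - ld) * c * (2 * a - la) * g a b (c - 1) (d + 1) := by
  funext a b c d
  simp only [opComm, Pi.sub_apply, Function.comp_apply, Mik, Mkm, add_sub_cancel_right, sub_add_cancel]
  push_cast
  ring

lemma commC (la lb lc ld : ℝ) (g : G) :
    opComm (Mik la lc) (opComm (Mjk lb lc) (Mkm lc ld)) g =
      (2 : ℝ) • Mjk lb lc (Mim la ld g) - (lb * lc) • Mim la ld g - (la * ld) • Mjk lb lc g
        - (2 : ℝ) • Mij la lb (Mkm lc ld g) + (la * lb) • Mkm lc ld g
        + (lc * ld) • Mij la lb g := by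
  funext a b c d
  rw [opComm]
  simp only [Pi.sub_apply, Pi.add_apply, Pi.smul_apply, smul_eq_mul, Function.comp_apply,
    commA la lb lc ld]
  simp only [Mij, Mik, Mim, Mjk, Mkm, add_sub_cancel_right, sub_add_cancel]
  push_cast
  ring

lemma commC' (la lb lc ld : ℝ) (g : G) :
    opComm (Mik la lc) (opComm (Mkm lc ld) (Mjm lb ld)) g =
      (2 : ℝ) • Mjk lb lc (Mim la ld g) - (lb * lc) • Mim la ld g - (la * ld) • Mjk lb lc g
        - (2 : ℝ) • Mij la lb (Mkm lc ld g) + (la * lb) • Mkm lc ld g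
        + (lc * ld) • Mij la lb g := by
  funext a b c d
  simp only [opComm, Pi.sub_apply, Pi.add_apply, Pi.smul_apply, smul_eq_mul, Function.comp_apply]
  simp only [Mij, Mik, Mim, Mjk, Mkm, Mjm, add_sub_cancel_right, sub_add_cancel, Pi.sub_apply]
  push_cast
  ring

set_option maxHeartbeats 0 in
set_option maxRecDepth 100000 in
lemma main4 (la lb lc ld : ℝ) :
    (lc * (2 + lc) * ld * (2 + ld)) • Mij la lb =
      opAComm (opComm (Mjk lb lc) (Mkm lc ld)) (opComm (Mik la lc) (Mkm lc ld))
      - opAComm (Mkm lc ld) (opComm (Mik la lc) (opComm (Mjk lb lc) (Mkm lc ld)))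
      - (2 : ℝ) • opAComm (Mkm lc ld) (Mik la lc ∘ Mjm lb ld)
      + (lc * ld) • opComm (Mik la lc) (opComm (Mkm lc ld) (Mjm lb ld))
      + (lb * ld) • opAComm (Mik la lc) (Mkm lc ld)
      - (ld * (ld + 2)) • opAComm (Mik la lc) (Mjk lb lc)
      - (lc * (lc + 2)) • opAComm (Mim la ld) (Mjm lb ld)
      + (la * lc) • opAComm (Mjm lb ld) (Mkm lc ld)
      - (4 : ℝ) • (Mjk lb lc ∘ Mim la ld)
      + (2 * (-2 + lc * ld)) • (Mik la lc ∘ Mjm lb ld)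
      + (2 * lb * (1 + lc) * ld) • Mik la lc
      + (lb * lc * (2 + 2 * ld + lc * ld)) • Mim la ld
      + (la * ld * (2 + 2 * lc + lc * ld)) • Mjk lb lc
      + (2 * la * lc * (1 + ld)) • Mjm lb ld
      - (la * lb * lc * ld) • Mkm lc ld := by
  funext g a b c d
  simp only [opAComm, Pi.sub_apply, Pi.add_apply, Pi.smul_apply, smul_eq_mul,
    Function.comp_apply, commC, commC', commA la lb lc ld, commB la lb lc ld]
  simp only [Mij, Mik, Mim, Mjk, Mkm, Mjm, add_sub_cancel_right, sub_add_cancel, Pi.sub_apply,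
    Pi.add_apply, Pi.smul_apply, smul_eq_mul]
  push_cast
  ring

/-- Restriction of a function to the four coordinates `i j k m` through `x`. -/
def T {n : ℕ} (i j k m : Fin n) (x : Fin n → ℤ) (f : (Fin n → ℤ) → ℝ) : G :=
  fun a b c d => f (fun t => if t = i then a else if t = j then b else if t = k then c
    else if t = m then d else x t)

def Semi {F H : Type*} (T : F → H) (A : F → F) (B : H → H) : Prop := ∀ f, T (A f) = B (T f)

section
variable {n : ℕ} {i j k m : Fin n} {x : Fin n → ℤ}
  {A A' : ((Fin n → ℤ) → ℝ) → ((Fin n → ℤ) → ℝ)} {B B' : G → G}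

lemma semi_comp (h : Semi (T i j k m x) A B) (h' : Semi (T i j k m x) A' B') :
    Semi (T i j k m x) (A ∘ A') (B ∘ B') := fun f => by
  simp only [Function.comp_apply]; rw [h, h']

lemma semi_add (h : Semi (T i j k m x) A B) (h' : Semi (T i j k m x) A' B') :
    Semi (T i j k m x) (A + A') (B + B') := fun f => by
  rw [Pi.add_apply, Pi.add_apply, ← h, ← h']; rfl

lemma semi_sub (h : Semi (T i j k m x) A B) (h' : Semi (T i j k m x) A' B') :
    Semi (T i j k m x) (A - A') (B - B') := fun f => by
  rw [Pi.sub_apply, Pi.sub_apply, ← h, ← h']; rfl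

lemma semi_smul (r : ℝ) (h : Semi (T i j k m x) A B) :
    Semi (T i j k m x) (r • A) (r • B) := fun f => by
  rw [Pi.smul_apply, Pi.smul_apply, ← h]; rfl

lemma semi_comm (h : Semi (T i j k m x) A B) (h' : Semi (T i j k m x) A' B') :
    Semi (T i j k m x) (opComm A A') (opComm B B') :=
  semi_sub (semi_comp h h') (semi_comp h' h)

lemma semi_acomm (h : Semi (T i j k m x) A B) (h' : Semi (T i j k m x) A' B') :
    Semi (T i j k m x) (opAComm A A') (opAComm B B') :=
  semi_add (semi_comp h h') (semi_comp h' h)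
end

section
variable {n : ℕ} (ℓ : Fin n → ℝ) {i j k m : Fin n} (x : Fin n → ℤ)

lemma semi_ij (hij : i ≠ j) (hik : i ≠ k) (him : i ≠ m) (hjk : j ≠ k) (hjm : j ≠ m)
    (hkm : k ≠ m) : Semi (T i j k m x) (Lop n ℓ i j) (Mij (ℓ i) (ℓ j)) := fun f => by
  funext a b c d
  simp only [T, Lop, Mij, hij, hik, him, hjk, hjm, hkm, hij.symm, hik.symm, him.symm, hjk.symm,
    hjm.symm, hkm.symm, if_true, if_false]
  congr 4 <;> congr 1 <;> funext t <;> simp only [Pi.add_apply, Pi.sub_apply, Pi.single_apply] <;>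
    split_ifs <;> simp_all

lemma semi_ik (hij : i ≠ j) (hik : i ≠ k) (him : i ≠ m) (hjk : j ≠ k) (hjm : j ≠ m)
    (hkm : k ≠ m) : Semi (T i j k m x) (Lop n ℓ i k) (Mik (ℓ i) (ℓ k)) := fun f => by
  funext a b c d
  simp only [T, Lop, Mik, hij, hik, him, hjk, hjm, hkm, hij.symm, hik.symm, him.symm, hjk.symm,
    hjm.symm, hkm.symm, if_true, if_false]
  congr 4 <;> congr 1 <;> funext t <;> simp only [Pi.add_apply, Pi.sub_apply, Pi.single_apply] <;>
    split_ifs <;> simp_all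

lemma semi_im (hij : i ≠ j) (hik : i ≠ k) (him : i ≠ m) (hjk : j ≠ k) (hjm : j ≠ m)
    (hkm : k ≠ m) : Semi (T i j k m x) (Lop n ℓ i m) (Mim (ℓ i) (ℓ m)) := fun f => by
  funext a b c d
  simp only [T, Lop, Mim, hij, hik, him, hjk, hjm, hkm, hij.symm, hik.symm, him.symm, hjk.symm,
    hjm.symm, hkm.symm, if_true, if_false]
  congr 4 <;> congr 1 <;> funext t <;> simp only [Pi.add_apply, Pi.sub_apply, Pi.single_apply] <;>
    split_ifs <;> simp_all

lemma semi_jk (hij : i ≠ j) (hik : i ≠ k) (him : i ≠ m) (hjk : j ≠ k) (hjm : j ≠ m)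
    (hkm : k ≠ m) : Semi (T i j k m x) (Lop n ℓ j k) (Mjk (ℓ j) (ℓ k)) := fun f => by
  funext a b c d
  simp only [T, Lop, Mjk, hij, hik, him, hjk, hjm, hkm, hij.symm, hik.symm, him.symm, hjk.symm,
    hjm.symm, hkm.symm, if_true, if_false]
  congr 4 <;> congr 1 <;> funext t <;> simp only [Pi.add_apply, Pi.sub_apply, Pi.single_apply] <;>
    split_ifs <;> simp_all

lemma semi_jm (hij : i ≠ j) (hik : i ≠ k) (him : i ≠ m) (hjk : j ≠ k) (hjm : j ≠ m)
    (hkm : k ≠ m) : Semi (T i j k m x) (Lop n ℓ j m) (Mjm (ℓ j) (ℓ m)) := fun f => by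
  funext a b c d
  simp only [T, Lop, Mjm, hij, hik, him, hjk, hjm, hkm, hij.symm, hik.symm, him.symm, hjk.symm,
    hjm.symm, hkm.symm, if_true, if_false]
  congr 4 <;> congr 1 <;> funext t <;> simp only [Pi.add_apply, Pi.sub_apply, Pi.single_apply] <;>
    split_ifs <;> simp_all

lemma semi_km (hij : i ≠ j) (hik : i ≠ k) (him : i ≠ m) (hjk : j ≠ k) (hjm : j ≠ m)
    (hkm : k ≠ m) : Semi (T i j k m x) (Lop n ℓ k m) (Mkm (ℓ k) (ℓ m)) := fun f => by
  funext a b c d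
  simp only [T, Lop, Mkm, hij, hik, him, hjk, hjm, hkm, hij.symm, hik.symm, him.symm, hjk.symm,
    hjm.symm, hkm.symm, if_true, if_false]
  congr 4 <;> congr 1 <;> funext t <;> simp only [Pi.add_apply, Pi.sub_apply, Pi.single_apply] <;>
    split_ifs <;> simp_all
end

end S11

/-- The nonlinear relation \eqref{3.12} satisfied by the operators `L_{i,j}`. -/
theorem stmt11 (n : ℕ) (hn : 4 ≤ n) (ℓ : Fin n → ℝ) (i j k m : Fin n)
    (hij : i ≠ j) (hik : i ≠ k) (him : i ≠ m)
    (hjk : j ≠ k) (hjm : j ≠ m) (hkm : k ≠ m) :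
    (ℓ k * (2 + ℓ k) * ℓ m * (2 + ℓ m)) • Lop n ℓ i j =
      opAComm (opComm (Lop n ℓ j k) (Lop n ℓ k m)) (opComm (Lop n ℓ i k) (Lop n ℓ k m))
      - opAComm (Lop n ℓ k m) (opComm (Lop n ℓ i k) (opComm (Lop n ℓ j k) (Lop n ℓ k m)))
      - (2 : ℝ) • opAComm (Lop n ℓ k m) (Lop n ℓ i k ∘ Lop n ℓ j m)
      + (ℓ k * ℓ m) • opComm (Lop n ℓ i k) (opComm (Lop n ℓ k m) (Lop n ℓ j m))
      + (ℓ j * ℓ m) • opAComm (Lop n ℓ i k) (Lop n ℓ k m)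
      - (ℓ m * (ℓ m + 2)) • opAComm (Lop n ℓ i k) (Lop n ℓ j k)
      - (ℓ k * (ℓ k + 2)) • opAComm (Lop n ℓ i m) (Lop n ℓ j m)
      + (ℓ i * ℓ k) • opAComm (Lop n ℓ j m) (Lop n ℓ k m)
      - (4 : ℝ) • (Lop n ℓ j k ∘ Lop n ℓ i m)
      + (2 * (-2 + ℓ k * ℓ m)) • (Lop n ℓ i k ∘ Lop n ℓ j m)
      + (2 * ℓ j * (1 + ℓ k) * ℓ m) • Lop n ℓ i k
      + (ℓ j * ℓ k * (2 + 2 * ℓ m + ℓ k * ℓ m)) • Lop n ℓ i m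
      + (ℓ i * ℓ m * (2 + 2 * ℓ k + ℓ k * ℓ m)) • Lop n ℓ j k
      + (2 * ℓ i * ℓ k * (1 + ℓ m)) • Lop n ℓ j m
      - (ℓ i * ℓ j * ℓ k * ℓ m) • Lop n ℓ k m := by
  funext f x
  have Sij := S11.semi_ij ℓ x hij hik him hjk hjm hkm
  have Sik := S11.semi_ik ℓ x hij hik him hjk hjm hkm
  have Sim := S11.semi_im ℓ x hij hik him hjk hjm hkm
  have Sjk := S11.semi_jk ℓ x hij hik him hjk hjm hkm
  have Sjm := S11.semi_jm ℓ x hij hik him hjk hjm hkm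
  have Skm := S11.semi_km ℓ x hij hik him hjk hjm hkm
  have key := S11.main4 (ℓ i) (ℓ j) (ℓ k) (ℓ m)
  have hx : ∀ F : (Fin n → ℤ) → ℝ, F x = S11.T i j k m x F (x i) (x j) (x k) (x m) := by
    intro F
    unfold S11.T
    congr 1
    funext t
    split_ifs <;> simp_all
  refine (hx _).trans (Eq.trans ?_ (hx _).symm)
  have hL := S11.semi_smul (ℓ k * (2 + ℓ k) * ℓ m * (2 + ℓ m)) Sij f
  rw [hL, key]
  clear hL key hx
  refine congrFun (congrFun (congrFun (congrFun (Eq.symm ?_) _) _) _) _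
  revert f
  change S11.Semi _ _ _
  repeat' first
    | assumption
    | with_reducible apply S11.semi_acomm
    | with_reducible apply S11.semi_comm
    | with_reducible apply S11.semi_smul
    | with_reducible apply S11.semi_add
    | with_reducible apply S11.semi_sub
    | with_reducible apply S11.semi_comp
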